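/- For all positive integers q and n and every subset B ⊆ {q, q+1, …, n+q−2}, the following identity holds in ℤ[t]: Σ_{π ∈ S_{n+q−1} : π⁻¹ ∈ Avoid_q(n+q−1) and Des_q(π⁻¹) = B} t^{rmaj_{q,n+q−1}(π)} = Σ_{π ∈ S_{n+q−1} : π⁻¹ ∈ Avoid_q(n+q−1) and Des_q(π⁻¹) = B} t^{inv_q(π)}. -/

import Mathlib

open Finset

/-- The Coxeter generator `s_j = (j, j+1)` of the symmetric group on `{1,…,m}`,
viewed as a permutation of `ℕ` (with 1-based positions). -/
def sgen (j : ℕ) : Equiv.Perm ℕ := Equiv.swap j (j + 1)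

/-- The permutation determined by a word in the Coxeter generators,
letters read from left to right and composed as functions. -/
def wordPerm (L : List ℕ) : Equiv.Perm ℕ := (L.map sgen).prod

/-- The canonical presentation of a permutation of `{1,…,m}` (given as a permutation of `ℕ`
supported on `{1,…,m}`): the unique factorization `w = w₁ w₂ ⋯ w_{m-1}` with
`w_j ∈ R_j = {1, s_j, s_j s_{j-1}, …, s_j ⋯ s_1}`, recorded as the list of indices of the
Coxeter generators appearing, read from left to right. -/
def canonWord : ℕ → Equiv.Perm ℕ → List ℕ
  | 0, _ => []
  | m + 1, π =>
      canonWord m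
          (π * (wordPerm ((List.range' (π⁻¹ (m + 1)) (m + 1 - π⁻¹ (m + 1))).reverse))⁻¹)
        ++ (List.range' (π⁻¹ (m + 1)) (m + 1 - π⁻¹ (m + 1))).reverse

def finIccEquiv (m : ℕ) : Fin m ≃ {i : ℕ // i ∈ Finset.Icc 1 m} where
  toFun a := ⟨a.1 + 1, by have := a.isLt; simp only [Finset.mem_Icc]; omega⟩
  invFun b := ⟨b.1 - 1, by have := b.2; simp only [Finset.mem_Icc] at this; omega⟩
  left_inv a := by ext; simp
  right_inv b := by
    have := b.2
    simp only [Finset.mem_Icc] at this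
    ext
    simp only []
    omega

/-- A permutation of `{1,…,m}`, i.e. of `Fin m`, viewed as a permutation of `ℕ`
(moving only the points `1,…,m`, with `i ∈ Fin m` corresponding to the point `i+1`). -/
def natPerm {m : ℕ} (π : Equiv.Perm (Fin m)) : Equiv.Perm ℕ :=
  π.extendDomain (finIccEquiv m)

/-- `Del_q` of a permutation of `{1,…,m}`: the set of positions `q+1 ≤ i ≤ m` that are
`(q-1)`-st almost left-to-right minima, i.e. `#{j < i : π(j) < π(i)} ≤ q - 1`. -/
def DelQ (q m : ℕ) (π : Equiv.Perm ℕ) : Finset ℕ :=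
  (Finset.Icc (q + 1) m).filter fun i =>
    ((Finset.Ico 1 i).filter fun j => π j < π i).card ≤ q - 1

/-- The descent set of a permutation of `{1,…,m}`: positions `1 ≤ i ≤ m-1` with `π(i) > π(i+1)`. -/
def DesSet (m : ℕ) (π : Equiv.Perm ℕ) : Finset ℕ :=
  (Finset.Icc 1 (m - 1)).filter fun i => π (i + 1) < π i

/-- `Des_q(π) = (Des(π) ∩ {q,…,m-1}) ∪ (Del_q(π) - 1)`. -/
def DesQ (q m : ℕ) (π : Equiv.Perm ℕ) : Finset ℕ :=
  DesSet m π ∩ Finset.Icc q (m - 1) ∪ (DelQ q m π).image (fun i => i - 1)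

/-- The `q`-inversion number of a permutation of `{1,…,m}`:
`inv_q(π) = Σ_{i=q+1}^m min(i-q, #{j < i : π(j) > π(i)})`. -/
def invQ (q m : ℕ) (π : Equiv.Perm ℕ) : ℕ :=
  ∑ i ∈ Finset.Icc (q + 1) m,
    min (i - q) ((Finset.Ico 1 i).filter fun j => π i < π j).card

/-- The `q`-reverse major index `rmaj_{q,m}(π) = Σ_{i ∈ Des_q(π)} (m - i)`. -/
def rmajQ (q m : ℕ) (π : Equiv.Perm ℕ) : ℕ :=
  ∑ i ∈ DesQ q m π, (m - i)

/-- The `q`-length of a permutation of `{1,…,m}`: the number of letters in the canonical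
presentation, where the generators `s_1, …, s_{q-1}` are not counted. -/
def ellQ (q m : ℕ) (π : Equiv.Perm ℕ) : ℕ :=
  ((canonWord m π).filter fun j => q ≤ j).length

/-- `del_q` of a permutation of `{1,…,m}`: the number of occurrences of the generator `s_q`
in the canonical presentation. -/
def delq (q m : ℕ) (π : Equiv.Perm ℕ) : ℕ := (canonWord m π).count q

/-- The covering map `f_q : S_m → S_{m-q+1}`, defined on the canonical presentation by
`s_j ↦ 1` if `j ≤ q-1` and `s_j ↦ s_{j-q+1}` if `j ≥ q`. -/
def fq (q m : ℕ) (π : Equiv.Perm ℕ) : Equiv.Perm ℕ :=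
  wordPerm (((canonWord m π).filter fun j => q ≤ j).map fun j => j - q + 1)

/-- A permutation of `{1,…,m}` avoids the pattern set `Pat(q)` iff there is no sequence
`1 ≤ i₁ < i₂ < ⋯ < i_{q+1} < m` with `π(i_{q+1}) > π(i_{q+1}+1)` and
`π(i_j) < π(i_{q+1}+1)` for all `1 ≤ j ≤ q`. -/
def AvoidsPat (q m : ℕ) (π : Equiv.Perm ℕ) : Prop :=
  ¬ ∃ f : Fin (q + 1) → ℕ, StrictMono f ∧ 1 ≤ f 0 ∧ f (Fin.last q) < m ∧
      π (f (Fin.last q) + 1) < π (f (Fin.last q)) ∧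
      ∀ a : Fin (q + 1), a ≠ Fin.last q → π (f a) < π (f (Fin.last q) + 1)

/-- The Stirling number of the second kind `S(n,k)`: the number of partitions of
`{1,…,n}` into `k` nonempty blocks. -/
noncomputable def stirling2 (n k : ℕ) : ℕ :=
  Nat.card {P : Finpartition (Finset.univ : Finset (Fin n)) // P.parts.card = k}

/-- The `q`-Bell number `b_q(n) = Σ_k q^k S(n,k)`. -/
noncomputable def qBell (q n : ℕ) : ℕ := ∑ k ∈ Finset.range (n + 1), q ^ k * stirling2 n k

/-- `h_q(m)`: the number of permutations of `{1,…,m}` avoiding all patterns in `Pat(q)`. -/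
noncomputable def hq (q m : ℕ) : ℕ :=
  Nat.card {π : Equiv.Perm (Fin m) // AvoidsPat q m (natPerm π)}

/-- The number of cycles (including fixed points) of a permutation of `{1,…,n}`. -/
def cycleCount {n : ℕ} (σ : Equiv.Perm (Fin n)) : ℕ :=
  σ.cycleType.card + (n - σ.support.card)

/-- The signless Stirling number of the first kind `c(n,k)`: the number of permutations
of `{1,…,n}` with exactly `k` cycles. -/
noncomputable def stirling1 (n k : ℕ) : ℕ :=
  Nat.card {σ : Equiv.Perm (Fin n) // cycleCount σ = k}

namespace PermList

/-- The number of entries smaller than `v` that precede the first occurrence of `v`. -/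
def smallerBefore (v : ℕ) : List ℕ → ℕ
  | [] => 0
  | x :: L => if x = v then 0 else (if x < v then 1 else 0) + smallerBefore v L

/-- The list whose entry at each position counts the smaller entries among `acc` and
the preceding positions. -/
def rankCodeAux (acc : List ℕ) : List ℕ → List ℕ
  | [] => []
  | x :: L => acc.countP (· < x) :: rankCodeAux (x :: acc) L

/-- The number of inversions of a list. -/
def inversions : List ℕ → ℕ
  | [] => 0
  | x :: L => L.countP (· < x) + inversions L

/-- The sum over the descents of a list of the number of entries after the descent. -/
def revMajor : List ℕ → ℕ
  | [] => 0
  | [_] => 0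
  | x :: y :: L => (if y < x then L.length + 1 else 0) + revMajor (y :: L)

/-! ### The Foata transformation built from the right -/

/-- Move each entry satisfying `P` to the position just before the next such entry,
where `s` is the entry currently being moved. -/
def rotate (P : ℕ → Bool) : ℕ → List ℕ → List ℕ
  | s, [] => [s]
  | s, y :: u => if P y then s :: rotate P y u else y :: rotate P s u

/-- One step of the Foata transformation: rotate the blocks cut out by comparison with `x`. -/
def foataStep (x : ℕ) : List ℕ → List ℕ
  | [] => []
  | a :: u => rotate (fun y => decide (y < x) == decide (a < x)) a u

/-- The Foata transformation, fixing the first letter. -/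
def foata : List ℕ → List ℕ
  | [] => []
  | x :: w => x :: foataStep x (foata w)

theorem rotate_perm (P : ℕ → Bool) (s : ℕ) (u : List ℕ) : (rotate P s u).Perm (s :: u) := by
  induction u generalizing s with
  | nil => simp [rotate]
  | cons y u ih =>
    rw [rotate]
    split_ifs
    · exact (ih y).cons s
    · exact ((ih s).cons y).trans (List.Perm.swap s y u)

theorem foataStep_perm (x : ℕ) (u : List ℕ) : (foataStep x u).Perm u := by
  cases u with
  | nil => simp [foataStep]
  | cons a u => exact rotate_perm _ a u

theorem foata_perm (w : List ℕ) : (foata w).Perm w := by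
  induction w with
  | nil => simp [foata]
  | cons x w ih => exact ((foataStep_perm x _).trans ih).cons x

theorem rotate_inj (P : ℕ → Bool) {s s' : ℕ} {u u' : List ℕ} (hs : P s) (hs' : P s')
    (h : rotate P s u = rotate P s' u') : s = s' ∧ u = u' := by
  induction u generalizing s s' u' with
  | nil =>
    have hl := congrArg List.length h
    rw [(rotate_perm P s []).length_eq, (rotate_perm P s' u').length_eq] at hl
    cases u' with
    | nil => simpa [rotate] using h
    | cons y u => simp at hl
  | cons y u ih =>
    have hl := congrArg List.length h
    rw [(rotate_perm P s _).length_eq, (rotate_perm P s' u').length_eq] at hl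
    cases u' with
    | nil => simp at hl
    | cons y' u' =>
      simp only [rotate] at h
      grind

theorem exists_getLast?_rotate (P : ℕ → Bool) {s : ℕ} (u : List ℕ) (hs : P s) :
    ∃ z, (rotate P s u).getLast? = some z ∧ P z := by
  induction u generalizing s with
  | nil => exact ⟨s, by simp [rotate], hs⟩
  | cons y u ih =>
    rw [rotate]
    split_ifs with hy
    · obtain ⟨z, hz, h⟩ := ih hy
      exact ⟨z, by simp [List.getLast?_cons, hz], h⟩
    · obtain ⟨z, hz, h⟩ := ih hs
      exact ⟨z, by simp [List.getLast?_cons, hz], h⟩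

theorem foataStep_injective (x : ℕ) : Function.Injective (foataStep x) := by
  intro u u' h
  have hl := congrArg List.length h
  rw [(foataStep_perm x u).length_eq, (foataStep_perm x u').length_eq] at hl
  cases u with
  | nil => cases u' with
    | nil => rfl
    | cons a u' => simp at hl
  | cons a u => cases u' with
    | nil => simp at hl
    | cons a' u' =>
      simp only [foataStep] at h
      obtain ⟨z, hz, hza⟩ :=
        exists_getLast?_rotate (fun y => decide (y < x) == decide (a < x)) (s := a) u (by simp)
      obtain ⟨z', hz', hza'⟩ :=
        exists_getLast?_rotate (fun y => decide (y < x) == decide (a' < x)) (s := a') u' (by simp)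
      rw [h, hz', Option.some_inj] at hz
      subst hz
      have haa : decide (a < x) = decide (a' < x) := by simp_all
      rw [haa] at h
      obtain ⟨rfl, rfl⟩ := rotate_inj _ (by simp [haa]) (by simp) h
      rfl

theorem foata_injective : Function.Injective foata := by
  intro w
  induction w with
  | nil =>
    intro w' h
    cases w' with
    | nil => rfl
    | cons => simp [foata] at h
  | cons x w ih =>
    intro w' h
    cases w' with
    | nil => simp [foata] at h
    | cons x' w' =>
      simp only [foata, List.cons.injEq] at h
      obtain ⟨rfl, h⟩ := h
      rw [ih (foataStep_injective x h)]

theorem inversions_rotate_lt {x s : ℕ} (u : List ℕ) (hs : s < x) :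
    inversions (rotate (fun y => decide (y < x)) s u) =
      inversions (s :: u) + u.countP (fun y => ! decide (y < x)) := by
  induction u generalizing s with
  | nil => simp [rotate]
  | cons y u ih =>
    rw [rotate]
    split_ifs with hy
    · have hy' : y < x := by simpa using hy
      rw [inversions, (rotate_perm _ y u).countP_eq, ih hy']
      simp [inversions, List.countP_cons, hy']
      omega
    · have hy' : ¬ y < x := by simpa using hy
      rw [inversions, (rotate_perm _ s u).countP_eq, ih hs]
      simp [inversions, hy', show s < y by omega, show ¬ y < s by omega]
      omega

theorem inversions_rotate_not_lt {x s : ℕ} (u : List ℕ) (hs : ¬ s < x) :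
    inversions (rotate (fun y => ! decide (y < x)) s u) + u.countP (fun y => decide (y < x)) =
      inversions (s :: u) := by
  induction u generalizing s with
  | nil => simp [rotate]
  | cons y u ih =>
    rw [rotate]
    split_ifs with hy
    · have hy' : ¬ y < x := by simpa using hy
      have := ih hy'
      rw [inversions, (rotate_perm _ y u).countP_eq]
      simp [inversions, List.countP_cons, hy'] at this ⊢
      omega
    · have hy' : y < x := by simpa using hy
      have := ih hs
      rw [inversions, (rotate_perm _ s u).countP_eq]
      simp [inversions, hy', show y < s by omega, show ¬ s < y by omega] at this ⊢
      omega

theorem inversions_foata (w : List ℕ) : inversions (foata w) = revMajor w := by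
  induction w with
  | nil => simp [foata, inversions, revMajor]
  | cons x w ih =>
    cases w with
    | nil => simp [foata, foataStep, inversions, revMajor]
    | cons y w =>
      rw [foata, inversions, (foataStep_perm x _).countP_eq, revMajor, ← ih]
      have hlen : (foata (y :: w)).length = w.length + 1 := by
        simpa using (foata_perm (y :: w)).length_eq
      rw [foata] at hlen ⊢
      set u := foataStep y (foata w)
      rw [foataStep]
      by_cases hy : y < x
      · have := inversions_rotate_lt u hy
        have hc := List.length_eq_countP_add_countP (fun z => decide (z < x)) (l := u)
        simp only [decide_not, Bool.decide_eq_true] at hc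
        simp [hy] at this hlen ⊢
        omega
      · have := inversions_rotate_not_lt u hy
        simp [hy] at this ⊢
        omega

theorem find?_rotate {P p : ℕ → Bool} {s : ℕ} (u : List ℕ) (hs : P s)
    (h : (∀ y, p y → P y) ∨ (∀ y, p y → ¬ P y)) :
    (rotate P s u).find? p = (s :: u).find? p := by
  induction u generalizing s with
  | nil => simp [rotate]
  | cons y u ih =>
    rw [rotate]
    split_ifs with hy
    · rw [List.find?_cons, ih hy, ← List.find?_cons]
    · rw [List.find?_cons, ih hs]
      simp only [List.find?_cons]
      grind

/-- The first entry in an order-convex set is preserved by the Foata transformation. -/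
theorem find?_foata {p : ℕ → Bool}
    (hp : ∀ x, ¬ p x → (∀ y, p y → y < x) ∨ (∀ y, p y → ¬ y < x)) (w : List ℕ) :
    (foata w).find? p = w.find? p := by
  induction w with
  | nil => simp [foata]
  | cons x w ih =>
    rw [foata, List.find?_cons, List.find?_cons, ← ih]
    by_cases hx : p x
    · simp [hx]
    · simp only [hx]
      cases foata w with
      | nil => simp [foataStep]
      | cons a u =>
        refine find?_rotate u (by simp) ?_
        have := hp x hx
        by_cases ha : a < x <;> simp only [ha] <;> simp <;> grind

theorem smallerBefore_lt_succ_iff (i : ℕ) (L : List ℕ) :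
    smallerBefore i L < smallerBefore (i + 1) L ↔
      L.find? (fun y => decide (y = i ∨ y = i + 1)) = some i := by
  induction L with
  | nil => simp [smallerBefore]
  | cons x L ih =>
    simp only [smallerBefore, List.find?_cons]
    grind

theorem smallerBefore_eq_zero_iff (v : ℕ) (L : List ℕ) :
    smallerBefore v L = 0 ↔
      L.find? (fun y => decide (y ≤ v)) = some v ∨ L.find? (fun y => decide (y ≤ v)) = none := by
  induction L with
  | nil => simp [smallerBefore]
  | cons x L ih =>
    simp only [smallerBefore, List.find?_cons]
    grind

/-- The condition that the entries `v > q` of `L` with `v - 1 ∈ B` are left-to-right minima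
and that the other entries `v` of `L` are preceded by `v - 1`. -/
def IsBlockShuffle (q m : ℕ) (B : Finset ℕ) (L : List ℕ) : Prop :=
  ∀ i ∈ Finset.Icc q (m - 1),
    if i ∈ B then smallerBefore (i + 1) L = 0 else smallerBefore i L < smallerBefore (i + 1) L

theorem isBlockShuffle_foata_iff (q m : ℕ) (B : Finset ℕ) (L : List ℕ) :
    IsBlockShuffle q m B (foata L) ↔ IsBlockShuffle q m B L := by
  simp only [IsBlockShuffle, smallerBefore_lt_succ_iff, smallerBefore_eq_zero_iff]
  refine forall₂_congr fun i _ => ?_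
  rw [find?_foata, find?_foata]
  · intro x hx; simp only [decide_eq_true_eq] at hx ⊢; grind
  · intro x hx; simp only [decide_eq_true_eq] at hx ⊢; grind

open Classical in
theorem sum_revMajor_eq_sum_inversions (q m : ℕ) (B : Finset ℕ) (L₀ : List ℕ) :
    ∑ L ∈ L₀.permutations.toFinset.filter (IsBlockShuffle q m B),
        (Polynomial.X : Polynomial ℤ) ^ revMajor L =
      ∑ L ∈ L₀.permutations.toFinset.filter (IsBlockShuffle q m B),
        (Polynomial.X : Polynomial ℤ) ^ inversions L := by
  set S := L₀.permutations.toFinset.filter (IsBlockShuffle q m B)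
  have himage : S.image foata = S := by
    refine Finset.eq_of_subset_of_card_le ?_
      (Finset.card_image_of_injective _ foata_injective).ge
    intro L hL
    obtain ⟨L', hL', rfl⟩ := Finset.mem_image.1 hL
    simp only [S, Finset.mem_filter, List.mem_toFinset, List.mem_permutations,
      isBlockShuffle_foata_iff] at hL' ⊢
    exact ⟨(foata_perm L').trans hL'.1, hL'.2⟩
  conv_rhs => rw [← himage, Finset.sum_image foata_injective.injOn]
  simp only [inversions_foata]

/-! ### The covering map as a sequence of bubble sort passes -/

/-- A bubble sort pass carrying the running minimum `s`, which is dropped at the end. -/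
def bubbleAux : ℕ → List ℕ → List ℕ
  | _, [] => []
  | s, x :: L => max s x :: bubbleAux (min s x) L

/-- A bubble sort pass dropping the minimal entry. -/
def bubble : List ℕ → List ℕ
  | [] => []
  | x :: L => bubbleAux x L

theorem exists_cons_bubbleAux_perm (s : ℕ) (L : List ℕ) :
    ∃ a, (a :: bubbleAux s L).Perm (s :: L) ∧ ∀ y ∈ s :: L, a ≤ y := by
  induction L generalizing s with
  | nil => exact ⟨s, by simp [bubbleAux]⟩
  | cons x L ih =>
    obtain ⟨a, ha, hle⟩ := ih (min s x)
    refine ⟨a, ?_, ?_⟩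
    · rw [bubbleAux]
      refine (List.Perm.swap _ _ _).trans ((ha.cons _).trans ?_)
      rcases le_total s x with h | h
      · simpa [h] using List.Perm.swap s x L
      · simp [h]
    · simp only [List.mem_cons, forall_eq_or_imp] at hle ⊢
      refine ⟨?_, ?_, hle.2⟩ <;> omega

theorem bubble_perm {a k : ℕ} {L : List ℕ} (h : L.Perm (List.range' a (k + 1))) :
    (bubble L).Perm (List.range' (a + 1) k) := by
  cases L with
  | nil => simpa using h.length_eq
  | cons x L =>
    obtain ⟨b, hb, hle⟩ := exists_cons_bubbleAux_perm x L
    have hba : b = a := by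
      have h1 : b ∈ List.range' a (k + 1) := (hb.trans h).subset (by simp)
      have h2 : a ∈ x :: L := h.symm.subset (by simp [List.range'_succ])
      have := hle a h2
      simp only [List.mem_range'_1] at h1
      omega
    subst hba
    rw [List.range'_succ] at h
    exact (hb.trans h).cons_inv

theorem smallerBefore_bubbleAux {s v : ℕ} {L : List ℕ} (hL : (s :: L).Nodup)
    (hv : v ∈ bubbleAux s L) :
    smallerBefore v (bubbleAux s L) = smallerBefore v (s :: L) - 1 := by
  induction L generalizing s with
  | nil => simp [bubbleAux] at hv
  | cons x L ih =>
    simp only [List.nodup_cons, List.mem_cons, not_or] at hL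
    rw [bubbleAux] at hv ⊢
    rcases lt_or_gt_of_ne hL.1.1 with h | h
    · rw [max_eq_right h.le, min_eq_left h.le] at hv ⊢
      have := @ih s (by simp [hL])
      simp only [smallerBefore, List.mem_cons] at hv this ⊢
      grind
    · rw [max_eq_left h.le, min_eq_right h.le] at hv ⊢
      have := @ih x (by simp [hL])
      simp only [smallerBefore, List.mem_cons] at hv this ⊢
      grind

theorem smallerBefore_bubble {v : ℕ} {L : List ℕ} (hL : L.Nodup) (hv : v ∈ bubble L) :
    smallerBefore v (bubble L) = smallerBefore v L - 1 := by
  cases L with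
  | nil => simp [bubble] at hv
  | cons x L => exact smallerBefore_bubbleAux hL hv

theorem rankCodeAux_congr {acc acc' : List ℕ} (h : acc.Perm acc') (L : List ℕ) :
    rankCodeAux acc L = rankCodeAux acc' L := by
  induction L generalizing acc acc' with
  | nil => rfl
  | cons x L ih => rw [rankCodeAux, rankCodeAux, h.countP_eq, ih (h.cons x)]

theorem rankCodeAux_bubbleAux {s : ℕ} {acc L : List ℕ} (hL : (s :: L).Nodup)
    (hs : ∀ y ∈ acc, s < y) :
    rankCodeAux acc (bubbleAux s L) = (rankCodeAux (s :: acc) L).map (· - 1) := by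
  induction L generalizing s acc with
  | nil => rfl
  | cons x L ih =>
    simp only [List.nodup_cons, List.mem_cons, not_or] at hL
    rw [bubbleAux, rankCodeAux, rankCodeAux, List.map_cons]
    rcases lt_or_gt_of_ne hL.1.1 with h | h
    · rw [max_eq_right h.le, min_eq_left h.le, ih (by simp [hL]) (by simp [h]; exact hs),
        rankCodeAux_congr (List.Perm.swap x s acc)]
      simp [h]
    · rw [max_eq_left h.le, min_eq_right h.le,
        ih (by simp [hL]) (by simp [h]; exact fun y hy => h.trans (hs y hy))]
      have h1 : acc.countP (· < s) = 0 := by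
        simp only [List.countP_eq_zero, decide_eq_true_eq]
        exact fun y hy => (hs y hy).not_gt
      have h2 : acc.countP (· < x) = 0 := by
        simp only [List.countP_eq_zero, decide_eq_true_eq]
        exact fun y hy => (h.trans (hs y hy)).not_gt
      simp [h1, h2, h.not_gt]

/-- The list whose entry at each position counts the preceding smaller entries. -/
def rankCode (L : List ℕ) : List ℕ := rankCodeAux [] L

theorem rankCode_bubble {L : List ℕ} (hL : L.Nodup) :
    rankCode (bubble L) = (rankCode L).tail.map (· - 1) := by
  cases L with
  | nil => rfl
  | cons x L => exact rankCodeAux_bubbleAux hL (by simp)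

theorem iterate_bubble_perm {a k n : ℕ} {L : List ℕ} (h : L.Perm (List.range' a (k + n))) :
    (bubble^[k] L).Perm (List.range' (a + k) n) := by
  induction k generalizing a L with
  | zero => simpa using h
  | succ k ih =>
    rw [Function.iterate_succ_apply, show a + (k + 1) = a + 1 + k by omega]
    exact ih (bubble_perm (by rwa [show k + n + 1 = k + 1 + n by omega]))

theorem rankCode_iterate_bubble {a k n : ℕ} {L : List ℕ} (h : L.Perm (List.range' a (k + n))) :
    rankCode (bubble^[k] L) = ((rankCode L).drop k).map (· - k) := by
  induction k generalizing a L with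
  | zero => simp
  | succ k ih =>
    rw [Function.iterate_succ_apply,
      ih (bubble_perm (by rwa [show k + n + 1 = k + 1 + n by omega])),
      rankCode_bubble (h.nodup_iff.2 List.nodup_range')]
    rw [← List.map_drop, List.map_map, List.drop_tail]
    refine List.map_congr_left fun r _ => ?_
    simp only [Function.comp_apply]
    omega

theorem smallerBefore_iterate_bubble {a k n v : ℕ} {L : List ℕ}
    (h : L.Perm (List.range' a (k + n))) (hv : v ∈ List.range' (a + k) n) :
    smallerBefore v (bubble^[k] L) = smallerBefore v L - k := by
  induction k generalizing a L with
  | zero => simp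
  | succ k ih =>
    have hb := bubble_perm (a := a) (k := k + n) (L := L)
      (by rwa [show k + n + 1 = k + 1 + n by omega])
    rw [Function.iterate_succ_apply, ih hb (by rwa [show a + 1 + k = a + (k + 1) by omega]),
      smallerBefore_bubble (h.nodup_iff.2 List.nodup_range') (hb.symm.subset _)]
    · omega
    · simp only [List.mem_range'_1] at hv ⊢
      omega

/-! ### Statistics in terms of the rank code -/

theorem rankCodeAux_eq_map {acc L : List ℕ} (hL : L.Nodup) :
    rankCodeAux acc L = L.map fun v => acc.countP (· < v) + smallerBefore v L := by
  induction L generalizing acc with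
  | nil => rfl
  | cons x L ih =>
    rw [List.nodup_cons] at hL
    rw [rankCodeAux, ih hL.2, List.map_cons]
    congr 1
    · simp [smallerBefore]
    · refine List.map_congr_left fun v hv => ?_
      have hne : x ≠ v := fun h => hL.1 (h ▸ hv)
      simp only [List.countP_cons, smallerBefore, hne, if_false, decide_eq_true_eq]
      omega

theorem rankCode_eq_map {L : List ℕ} (hL : L.Nodup) :
    rankCode L = L.map fun v => smallerBefore v L := by
  simpa [rankCode] using rankCodeAux_eq_map (acc := []) hL

theorem rankCodeAux_append (acc A L : List ℕ) :
    rankCodeAux acc (A ++ L) = rankCodeAux acc A ++ rankCodeAux (A.reverse ++ acc) L := by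
  induction A generalizing acc with
  | nil => rfl
  | cons x A ih => simp [rankCodeAux, ih]

theorem countP_lt_strictMonoOn {L : List ℕ} {x y : ℕ} (hx : x ∈ L) (hxy : x < y) :
    L.countP (· < x) < L.countP (· < y) := by
  induction L with
  | nil => simp at hx
  | cons z L ih =>
    have hmono : L.countP (· < x) ≤ L.countP (· < y) :=
      List.countP_mono_left fun a _ ha => by simp at ha ⊢; omega
    simp only [List.countP_cons, decide_eq_true_eq]
    rcases List.mem_cons.1 hx with rfl | hx
    · simp [hxy]; omega
    · have := ih hx
      split_ifs <;> omega

theorem countP_lt_injOn {L : List ℕ} {x y : ℕ} (hx : x ∈ L) (hy : y ∈ L)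
    (h : L.countP (· < x) = L.countP (· < y)) : x = y := by
  rcases lt_trichotomy x y with hxy | hxy | hxy
  · exact absurd h (countP_lt_strictMonoOn hx hxy).ne
  · exact hxy
  · exact absurd h (countP_lt_strictMonoOn hy hxy).ne'

theorem rankCode_injOn {L L' : List ℕ} (hp : L.Perm L') (h : rankCode L = rankCode L') :
    L = L' := by
  induction L using List.reverseRecOn generalizing L' with
  | nil => exact hp.nil_eq
  | append_singleton A x ih =>
    cases L' using List.reverseRecOn with
    | nil => simpa using hp.length_eq
    | append_singleton A' x' =>
      simp only [rankCode, rankCodeAux_append, rankCodeAux, List.append_nil] at h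
      obtain ⟨h1, h2⟩ := List.append_inj' h rfl
      have hx : x = x' := by
        refine countP_lt_injOn (L := A ++ [x]) (by simp) (hp.symm.subset (by simp)) ?_
        simp only [List.countP_reverse, List.cons.injEq, and_true] at h2
        have := hp.countP_eq (· < x')
        simp [List.countP_append] at this h2 ⊢
        omega
      subst hx
      rw [ih ((List.perm_append_right_iff _).1 hp) h1]

/-- The number of inversions computed from a rank code starting at position `k`. -/
def codeInversions : ℕ → List ℕ → ℕ
  | _, [] => 0
  | k, r :: c => (k - r) + codeInversions (k + 1) c

/-- The reverse major index computed from a rank code. -/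
def codeRevMajor : List ℕ → ℕ
  | [] => 0
  | [_] => 0
  | r :: s :: c => (if s ≤ r then c.length + 1 else 0) + codeRevMajor (s :: c)

theorem codeInversions_rankCodeAux {acc L : List ℕ} (h : (acc ++ L).Nodup) :
    codeInversions acc.length (rankCodeAux acc L) =
      inversions L + (L.map fun x => acc.countP (x < ·)).sum := by
  induction L generalizing acc with
  | nil => rfl
  | cons x L ih =>
    rw [List.nodup_middle] at h
    have hx : acc.countP (x < ·) = acc.length - acc.countP (· < x) := by
      rw [List.length_eq_countP_add_countP (fun y => decide (y < x)), Nat.add_sub_cancel_left]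
      refine List.countP_congr fun y hy => ?_
      have : x ≠ y := by rintro rfl; simp [hy] at h
      simp; omega
    have hsum : (L.map fun y => (x :: acc).countP (y < ·)).sum =
        (L.map fun y => acc.countP (y < ·)).sum + L.countP (· < x) := by
      clear ih h
      induction L with
      | nil => rfl
      | cons y L ih => simp [List.countP_cons] at ih ⊢; omega
    have := ih (acc := x :: acc) (by simpa using h)
    rw [rankCodeAux, codeInversions, ← List.length_cons (a := x), this, hsum, inversions,
      List.map_cons, List.sum_cons, hx]
    omega

theorem codeInversions_rankCode {L : List ℕ} (h : L.Nodup) :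
    codeInversions 0 (rankCode L) = inversions L := by
  simpa [rankCode] using codeInversions_rankCodeAux (acc := []) (by simpa using h)

theorem length_rankCodeAux (acc L : List ℕ) : (rankCodeAux acc L).length = L.length := by
  induction L generalizing acc with
  | nil => rfl
  | cons x L ih => simp [rankCodeAux, ih]

theorem codeRevMajor_rankCodeAux {acc L : List ℕ} (h : L.Nodup) :
    codeRevMajor (rankCodeAux acc L) = revMajor L := by
  induction L generalizing acc with
  | nil => rfl
  | cons x L ih =>
    cases L with
    | nil => rfl
    | cons y L =>
      have hxy : x ≠ y := by rintro rfl; simp at h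
      have := ih (acc := x :: acc) (List.nodup_cons.1 h).2
      rw [rankCodeAux] at this
      rw [rankCodeAux, rankCodeAux, codeRevMajor, revMajor, this, length_rankCodeAux]
      congr 2
      rw [eq_iff_iff, List.countP_cons]
      rcases lt_or_gt_of_ne hxy with hlt | hlt
      · have hmono : acc.countP (· < x) ≤ acc.countP (· < y) :=
          List.countP_mono_left fun a _ ha => by simp at ha ⊢; omega
        simp [hlt]; omega
      · have hmono : acc.countP (· < y) ≤ acc.countP (· < x) :=
          List.countP_mono_left fun a _ ha => by simp at ha ⊢; omega
        simp [hlt, hlt.not_gt]; omega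

theorem codeInversions_map_range' (k n s : ℕ) (f : ℕ → ℕ) :
    codeInversions k ((List.range' s n).map f) = ∑ j ∈ Finset.range n, (k + j - f (s + j)) := by
  induction n generalizing k s with
  | zero => rfl
  | succ n ih =>
    rw [List.range'_succ, List.map_cons, codeInversions, ih, Finset.sum_range_succ', add_comm]
    simp [add_comm, add_left_comm]

theorem codeRevMajor_map_range' (n s : ℕ) (f : ℕ → ℕ) :
    codeRevMajor ((List.range' s (n + 1)).map f) =
      ∑ j ∈ Finset.range n, if f (s + j + 1) ≤ f (s + j) then n - j else 0 := by
  induction n generalizing s with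
  | zero => rfl
  | succ n ih =>
    have := ih (s + 1)
    rw [List.range'_succ, List.map_cons] at this
    rw [List.range'_succ, List.range'_succ, List.map_cons, List.map_cons, codeRevMajor, this,
      Finset.sum_range_succ', add_comm]
    simp [add_comm, add_left_comm]

/-! ### From permutations to lists -/

/-- The number of smaller values of `p` at the positions `1, …, k - 1`. -/
def rankAt (p : Equiv.Perm ℕ) (k : ℕ) : ℕ := ((Finset.Ico 1 k).filter fun j => p j < p k).card

theorem rankAt_lt (p : Equiv.Perm ℕ) {k : ℕ} (hk : 1 ≤ k) : rankAt p k < k := by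
  have := Finset.card_filter_le (Finset.Ico 1 k) fun j => p j < p k
  rw [Nat.card_Ico] at this
  rw [rankAt]
  omega

theorem lt_iff_rankAt_le (p : Equiv.Perm ℕ) {i : ℕ} (hi : 1 ≤ i) :
    p (i + 1) < p i ↔ rankAt p (i + 1) ≤ rankAt p i := by
  constructor
  · intro h
    refine Finset.card_le_card fun j hj => ?_
    simp only [Finset.mem_filter, Finset.mem_Ico] at hj ⊢
    have : j ≠ i := by rintro rfl; omega
    omega
  · contrapose!
    intro h
    have hne : p i ≠ p (i + 1) := p.injective.ne (by omega)
    refine Finset.card_lt_card (Finset.ssubset_iff.2 ⟨i, by simp, fun j hj => ?_⟩)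
    simp only [Finset.mem_insert, Finset.mem_filter, Finset.mem_Ico] at hj ⊢
    rcases hj with rfl | hj <;> omega

theorem desQ_eq_filter {q m : ℕ} (hq : 0 < q) (p : Equiv.Perm ℕ) :
    DesQ q m p = (Finset.Icc q (m - 1)).filter fun i =>
      rankAt p (i + 1) ≤ rankAt p i ∨ rankAt p (i + 1) < q := by
  ext i
  simp only [DesQ, DesSet, DelQ, Finset.mem_union, Finset.mem_inter, Finset.mem_filter,
    Finset.mem_Icc, Finset.mem_image]
  constructor
  · rintro (⟨⟨h1, h2⟩, h3⟩ | ⟨j, ⟨h1, h2⟩, rfl⟩)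
    · exact ⟨h3, Or.inl ((lt_iff_rankAt_le p h1.1).1 h2)⟩
    · obtain ⟨i, rfl⟩ : ∃ i, j = i + 1 := ⟨j - 1, by omega⟩
      refine ⟨by omega, Or.inr ?_⟩
      rw [Nat.add_sub_cancel, rankAt]
      omega
  · rintro ⟨h1, h2 | h2⟩
    · exact Or.inl ⟨⟨by omega, (lt_iff_rankAt_le p (by omega)).2 h2⟩, h1⟩
    · rw [rankAt] at h2
      exact Or.inr ⟨i + 1, ⟨by omega, by omega⟩, by omega⟩

theorem avoidsPat_iff {q m : ℕ} (p : Equiv.Perm ℕ) :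
    AvoidsPat q m p ↔ ∀ i, 1 ≤ i → i < m → p (i + 1) < p i → rankAt p (i + 1) < q := by
  rw [AvoidsPat, ← not_iff_not, not_not]
  push Not
  constructor
  · rintro ⟨f, hf, h0, hm, hdes, hlt⟩
    refine ⟨f (Fin.last q), h0.trans (hf.monotone (Fin.zero_le _)), hm, hdes, ?_⟩
    have hsub : (Finset.univ : Finset (Fin q)).image (fun a => f a.castSucc) ⊆
        (Finset.Ico 1 (f (Fin.last q) + 1)).filter fun j => p j < p (f (Fin.last q) + 1) := by
      intro j hj
      obtain ⟨a, -, rfl⟩ := Finset.mem_image.1 hj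
      have h1 := h0.trans (hf.monotone (Fin.zero_le a.castSucc))
      have h2 := hf (Fin.castSucc_lt_last a)
      simp only [Finset.mem_filter, Finset.mem_Ico]
      exact ⟨by omega, hlt _ (Fin.castSucc_lt_last a).ne⟩
    have := Finset.card_le_card hsub
    rwa [Finset.card_image_of_injective _
        (show Function.Injective fun a : Fin q => f a.castSucc from
          hf.injective.comp (Fin.castSucc_injective q)),
      Finset.card_univ, Fintype.card_fin] at this
  · rintro ⟨i, h1, hm, hdes, hcard⟩
    obtain ⟨s, hs, hsq⟩ := Finset.exists_subset_card_eq hcard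
    have hmem : ∀ a : Fin q, 1 ≤ s.orderEmbOfFin hsq a ∧ s.orderEmbOfFin hsq a < i ∧
        p (s.orderEmbOfFin hsq a) < p (i + 1) := by
      intro a
      have ha := hs (s.orderEmbOfFin_mem hsq a)
      simp only [Finset.mem_filter, Finset.mem_Ico] at ha
      have : s.orderEmbOfFin hsq a ≠ i := by
        intro h
        rw [h] at ha
        omega
      omega
    refine ⟨Fin.snoc (α := fun _ => ℕ) (s.orderEmbOfFin hsq) i, ?_, ?_, by simpa using hm,
      by simpa using hdes, ?_⟩
    · intro a b hab
      induction b using Fin.lastCases with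
      | last =>
        induction a using Fin.lastCases with
        | last => exact absurd hab (lt_irrefl _)
        | cast a => simpa using (hmem a).2.1
      | cast b =>
        induction a using Fin.lastCases with
        | last => exact absurd hab (Fin.castSucc_lt_last b).not_gt
        | cast a => simpa using hab
    · generalize (0 : Fin (q + 1)) = a
      induction a using Fin.lastCases with
      | last => simpa using h1
      | cast a => simpa using (hmem a).1
    · intro a ha
      induction a using Fin.lastCases with
      | last => exact absurd rfl ha
      | cast a => simpa using (hmem a).2.2

theorem avoidsPat_and_desQ_eq_iff {q m : ℕ} (hq : 0 < q) {B : Finset ℕ}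
    (hB : B ⊆ Finset.Icc q (m - 1)) (p : Equiv.Perm ℕ) :
    AvoidsPat q m p ∧ DesQ q m p = B ↔ ∀ i ∈ Finset.Icc q (m - 1),
      if i ∈ B then rankAt p (i + 1) < q
      else q ≤ rankAt p (i + 1) ∧ rankAt p i < rankAt p (i + 1) := by
  rw [avoidsPat_iff, desQ_eq_filter hq]
  constructor
  · rintro ⟨hav, hdes⟩ i hi
    have hi' := Finset.mem_Icc.1 hi
    have hmem := congrArg (i ∈ ·) hdes
    simp only [Finset.mem_filter, hi, true_and, eq_iff_iff] at hmem
    have := hav i (by omega) (by omega)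
    rw [lt_iff_rankAt_le p (by omega)] at this
    split_ifs with h
    · have := hmem.2 h
      omega
    · have := mt hmem.1 h
      omega
  · intro h
    constructor
    · intro i h1 hm hdes
      rw [lt_iff_rankAt_le p h1] at hdes
      by_cases hiq : q ≤ i
      · have := h i (Finset.mem_Icc.2 (by omega))
        split_ifs at this <;> omega
      · have := rankAt_lt p h1
        omega
    · ext i
      simp only [Finset.mem_filter]
      constructor
      · rintro ⟨hi, hle⟩
        by_contra hiB
        have := h i hi
        rw [if_neg hiB] at this
        omega
      · intro hi
        have := h i (hB hi)
        rw [if_pos hi] at this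
        exact ⟨hB hi, Or.inr this⟩

/-- The one-line notation of a permutation of `{1, …, m}`. -/
def word (m : ℕ) (p : Equiv.Perm ℕ) : List ℕ := (List.range' 1 m).map p

theorem smallerBefore_map_range' (p : Equiv.Perm ℕ) {s n k : ℕ} (hk : k ∈ List.range' s n) :
    smallerBefore (p k) ((List.range' s n).map p) =
      ((Finset.Ico s k).filter fun j => p j < p k).card := by
  induction n generalizing s with
  | zero => simp at hk
  | succ n ih =>
    rw [List.range'_succ, List.mem_cons] at hk
    rw [List.range'_succ, List.map_cons, smallerBefore]
    by_cases hks : k = s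
    · subst hks
      simp
    · replace hk := hk.resolve_left hks
      have hsk : s < k := by simp only [List.mem_range'_1] at hk; omega
      rw [if_neg (p.injective.ne (Ne.symm hks)), ih hk, ← Finset.insert_Ico_succ_left_eq_Ico hsk,
        Finset.filter_insert]
      split_ifs with h
      · rw [Finset.card_insert_of_notMem (by simp), Order.succ_eq_add_one, add_comm]
      · rw [Order.succ_eq_add_one, zero_add]

theorem nodup_word (m : ℕ) (p : Equiv.Perm ℕ) : (word m p).Nodup :=
  List.Nodup.map p.injective List.nodup_range'

theorem rankCode_word (m : ℕ) (p : Equiv.Perm ℕ) :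
    rankCode (word m p) = (List.range' 1 m).map (rankAt p) := by
  rw [rankCode_eq_map (nodup_word m p), word, List.map_map]
  exact List.map_congr_left fun k hk => smallerBefore_map_range' p hk

theorem natPerm_mem_Icc {m : ℕ} (π : Equiv.Perm (Fin m)) {k : ℕ} (hk : k ∈ Finset.Icc 1 m) :
    natPerm π k ∈ Finset.Icc 1 m := by
  rw [natPerm, Equiv.Perm.extendDomain_apply_subtype π (finIccEquiv m) hk]
  exact Subtype.property _

theorem natPerm_inv {m : ℕ} (π : Equiv.Perm (Fin m)) : natPerm π⁻¹ = (natPerm π)⁻¹ :=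
  (Equiv.Perm.extendDomain_inv π (finIccEquiv m)).symm

theorem word_natPerm_perm {m : ℕ} (π : Equiv.Perm (Fin m)) :
    (word m (natPerm π)).Perm (List.range' 1 m) := by
  refine (List.perm_ext_iff_of_nodup (nodup_word m _) List.nodup_range').2 fun v => ?_
  have hmem : ∀ k, k ∈ List.range' 1 m ↔ k ∈ Finset.Icc 1 m := by
    intro k
    simp only [List.mem_range'_1, Finset.mem_Icc]
    omega
  simp only [word, List.mem_map, hmem]
  constructor
  · rintro ⟨k, hk, rfl⟩
    exact natPerm_mem_Icc π hk
  · intro hv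
    refine ⟨natPerm π⁻¹ v, natPerm_mem_Icc _ hv, ?_⟩
    rw [natPerm_inv]
    exact (natPerm π).apply_symm_apply v

theorem smallerBefore_word {m : ℕ} (π : Equiv.Perm (Fin m)) {v : ℕ} (hv : v ∈ Finset.Icc 1 m) :
    smallerBefore v (word m (natPerm π)) = rankAt (natPerm π⁻¹) v := by
  have hk := natPerm_mem_Icc π⁻¹ hv
  rw [natPerm_inv] at hk ⊢
  set p := natPerm π with hp
  have hk' : p⁻¹ v ∈ List.range' 1 m := by
    simp only [List.mem_range'_1, Finset.mem_Icc] at hk ⊢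
    omega
  have happly : ∀ u, p (p⁻¹ u) = u := p.apply_symm_apply
  have hinv : ∀ j, p⁻¹ (p j) = j := p.symm_apply_apply
  have := smallerBefore_map_range' p hk'
  rw [happly] at this
  rw [word, this, rankAt]
  refine Finset.card_bij' (fun j _ => p j) (fun u _ => p⁻¹ u) ?_ ?_ (fun j _ => hinv j)
    (fun u _ => happly u)
  · intro j hj
    simp only [Finset.mem_filter, Finset.mem_Ico, Finset.mem_Icc, hinv] at hj hk ⊢
    have := Finset.mem_Icc.1 (natPerm_mem_Icc π (k := j) (Finset.mem_Icc.2 (by omega)))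
    rw [← hp] at this
    omega
  · intro u hu
    simp only [Finset.mem_filter, Finset.mem_Ico, Finset.mem_Icc, happly] at hu hv ⊢
    have := Finset.mem_Icc.1 (natPerm_mem_Icc π⁻¹ (k := u) (Finset.mem_Icc.2 (by omega)))
    rw [natPerm_inv, ← hp] at this
    omega

/-- The covering map, from permutations of `{1, …, m}` to arrangements of `q, …, m`. -/
def cover (q : ℕ) {m : ℕ} (π : Equiv.Perm (Fin m)) : List ℕ :=
  bubble^[q - 1] (word m (natPerm π))

theorem word_natPerm_perm_range' {q n : ℕ} (hq : 0 < q) (π : Equiv.Perm (Fin (n + q - 1))) :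
    (word (n + q - 1) (natPerm π)).Perm (List.range' 1 (q - 1 + n)) := by
  rw [show q - 1 + n = n + q - 1 by omega]
  exact word_natPerm_perm π

theorem cover_perm {q n : ℕ} (hq : 0 < q) (π : Equiv.Perm (Fin (n + q - 1))) :
    (cover q π).Perm (List.range' q n) := by
  have := iterate_bubble_perm (word_natPerm_perm_range' hq π)
  rwa [show 1 + (q - 1) = q by omega] at this

theorem rankCode_cover {q n : ℕ} (hq : 0 < q) (π : Equiv.Perm (Fin (n + q - 1))) :
    rankCode (cover q π) =
      (List.range' q n).map fun k => rankAt (natPerm π) k - (q - 1) := by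
  rw [cover, rankCode_iterate_bubble (word_natPerm_perm_range' hq π), rankCode_word,
    ← List.map_drop, List.drop_range', List.map_map]
  rw [show 1 + (q - 1) * 1 = q by omega, show n + q - 1 - (q - 1) = n by omega]
  rfl

theorem smallerBefore_cover {q n : ℕ} (hq : 0 < q) (π : Equiv.Perm (Fin (n + q - 1)))
    {v : ℕ} (hv : v ∈ List.range' q n) :
    smallerBefore v (cover q π) = rankAt (natPerm π⁻¹) v - (q - 1) := by
  rw [cover, smallerBefore_iterate_bubble (word_natPerm_perm_range' hq π)
    (by rwa [show 1 + (q - 1) = q by omega]), smallerBefore_word]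
  simp only [List.mem_range'_1, Finset.mem_Icc] at hv ⊢
  omega

theorem isBlockShuffle_cover_iff {q n : ℕ} (hq : 0 < q) (π : Equiv.Perm (Fin (n + q - 1)))
    {B : Finset ℕ} (hB : B ⊆ Finset.Icc q (n + q - 2)) :
    IsBlockShuffle q (n + q - 1) B (cover q π) ↔
      AvoidsPat q (n + q - 1) (natPerm π⁻¹) ∧ DesQ q (n + q - 1) (natPerm π⁻¹) = B := by
  rw [avoidsPat_and_desQ_eq_iff hq (by rwa [show n + q - 1 - 1 = n + q - 2 by omega])]
  refine forall₂_congr fun i hi => ?_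
  rw [Finset.mem_Icc] at hi
  rw [smallerBefore_cover hq π (by simp only [List.mem_range'_1]; omega),
    smallerBefore_cover hq π (by simp only [List.mem_range'_1]; omega)]
  split_ifs <;> omega

theorem nodup_cover {q n : ℕ} (hq : 0 < q) (π : Equiv.Perm (Fin (n + q - 1))) :
    (cover q π).Nodup :=
  (cover_perm hq π).nodup_iff.2 List.nodup_range'

theorem invQ_eq_inversions_cover {q n : ℕ} (hq : 0 < q) (π : Equiv.Perm (Fin (n + q - 1))) :
    invQ q (n + q - 1) (natPerm π) = inversions (cover q π) := by
  rw [← codeInversions_rankCode (nodup_cover hq π), rankCode_cover hq, codeInversions_map_range']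
  cases n with
  | zero => rw [invQ, Finset.Icc_eq_empty (by omega)]; rfl
  | succ n =>
    have hIcc : Finset.Icc (q + 1) (n + 1 + q - 1) = Finset.Ico (q + 1) (q + 1 + n) := by
      ext; simp only [Finset.mem_Icc, Finset.mem_Ico]; omega
    rw [invQ, hIcc, Finset.sum_Ico_eq_sum_range, Finset.sum_range_succ']
    simp only [add_tsub_cancel_left, add_zero, zero_add, zero_tsub]
    refine Finset.sum_congr rfl fun j _ => ?_
    set p := natPerm π
    have hcompl : ((Finset.Ico 1 (q + 1 + j)).filter fun k => p (q + 1 + j) < p k).card +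
        rankAt p (q + 1 + j) = q + j := by
      rw [rankAt, ← Finset.card_union_of_disjoint, ← Finset.filter_or, Finset.filter_true_of_mem,
        Nat.card_Ico]
      · omega
      · intro k hk
        rw [Finset.mem_Ico] at hk
        exact (p.injective.ne (by omega)).lt_or_gt
      · rw [Finset.disjoint_filter]
        intros; omega
    rw [show q + (j + 1) = q + 1 + j by omega]
    omega

theorem rmajQ_eq_revMajor_cover {q n : ℕ} (hq : 0 < q) (π : Equiv.Perm (Fin (n + q - 1))) :
    rmajQ q (n + q - 1) (natPerm π) = revMajor (cover q π) := by
  rw [← codeRevMajor_rankCodeAux (acc := []) (nodup_cover hq π), ← rankCode, rankCode_cover hq]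
  rw [rmajQ, desQ_eq_filter hq]
  cases n with
  | zero => rw [Finset.Icc_eq_empty (by omega)]; rfl
  | succ n =>
    have hIcc : Finset.Icc q (n + 1 + q - 1 - 1) = Finset.Ico q (q + n) := by
      ext; simp only [Finset.mem_Icc, Finset.mem_Ico]; omega
    rw [codeRevMajor_map_range', hIcc, Finset.sum_filter, Finset.sum_Ico_eq_sum_range,
      add_tsub_cancel_left]
    refine Finset.sum_congr rfl fun j _ => ?_
    split_ifs <;> omega

/-! ### The fibers of the covering map -/

/-- The rank code of a permutation of `{1, …, m}`, as a function. -/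
def rankFun {m : ℕ} (π : Equiv.Perm (Fin m)) (j : Fin m) : ℕ := rankAt (natPerm π) (j + 1)

theorem natPerm_val_add_one {m : ℕ} (π : Equiv.Perm (Fin m)) (j : Fin m) :
    natPerm π (j + 1) = π j + 1 :=
  Equiv.Perm.extendDomain_apply_image π (finIccEquiv m) j

theorem rankFun_injective (m : ℕ) : Function.Injective (rankFun (m := m)) := by
  intro π π' h
  have hcode : rankCode (word m (natPerm π)) = rankCode (word m (natPerm π')) := by
    rw [rankCode_word, rankCode_word]
    refine List.map_congr_left fun k hk => ?_
    rw [List.mem_range'_1] at hk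
    have := congrFun h ⟨k - 1, by omega⟩
    simpa [rankFun, Nat.sub_add_cancel hk.1] using this
  have hword := rankCode_injOn ((word_natPerm_perm π).trans (word_natPerm_perm π').symm) hcode
  rw [word, word, List.map_inj_left] at hword
  ext j
  have := hword (j + 1) (by rw [List.mem_range'_1]; omega)
  rw [natPerm_val_add_one, natPerm_val_add_one] at this
  omega

theorem image_rankFun (m : ℕ) :
    Finset.univ.image (rankFun (m := m)) =
      Fintype.piFinset fun j : Fin m => Finset.range (j + 1) := by
  refine Finset.eq_of_subset_of_card_le ?_ ?_
  · intro f hf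
    obtain ⟨π, -, rfl⟩ := Finset.mem_image.1 hf
    rw [Fintype.mem_piFinset]
    exact fun j => Finset.mem_range.2 (rankAt_lt _ (by omega))
  · rw [Finset.card_image_of_injective _ (rankFun_injective m), Finset.card_univ,
      Fintype.card_perm, Fintype.card_fin, Fintype.card_piFinset]
    simp only [Finset.card_range]
    rw [Fin.prod_univ_eq_prod_range (fun j => j + 1), Finset.prod_range_add_one_eq_factorial]

theorem rankCodeAux_getD_le (acc L : List ℕ) (k : ℕ) :
    (rankCodeAux acc L).getD k 0 ≤ acc.length + k := by
  induction L generalizing acc k with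
  | nil => simp [rankCodeAux]
  | cons x L ih =>
    cases k with
    | zero => simpa [rankCodeAux] using List.countP_le_length
    | succ k =>
      have := ih (x :: acc) k
      simp [rankCodeAux] at this ⊢
      omega

theorem eq_map_range'_getD (c : List ℕ) (s : ℕ) :
    c = (List.range' s c.length).map fun k => c.getD (k - s) 0 := by
  refine List.ext_getElem (by simp) fun i h _ => ?_
  simp [h]

theorem prod_range_getD (F : ℕ → ℕ) (c : List ℕ) :
    ∏ k ∈ Finset.range c.length, F (c.getD k 0) = (c.map F).prod := by
  induction c with
  | nil => rfl
  | cons r c ih =>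
    rw [List.length_cons, Finset.prod_range_succ', List.map_cons, List.prod_cons, ← ih, mul_comm]
    simp

theorem smallerBefore_eq_zero_of_forall_le {v : ℕ} {L : List ℕ} (h : ∀ x ∈ L, v ≤ x) :
    smallerBefore v L = 0 := by
  induction L with
  | nil => rfl
  | cons x L ih =>
    rw [List.forall_mem_cons] at h
    rw [smallerBefore, ih h.2]
    simp [h.1.not_gt]

theorem IsBlockShuffle.smallerBefore_eq_zero_iff {q m n : ℕ} {B : Finset ℕ} {L : List ℕ}
    (h : IsBlockShuffle q m B L) (hL : L.Perm (List.range' q n)) (hm : m + 1 = n + q) {v : ℕ}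
    (hv : v ∈ List.range' q n) : smallerBefore v L = 0 ↔ v = q ∨ v - 1 ∈ B := by
  by_cases hvq : v = q
  · subst hvq
    simp only [true_or, iff_true]
    refine smallerBefore_eq_zero_of_forall_le fun x hx => ?_
    exact (List.mem_range'_1.1 (hL.subset hx)).1
  · rw [List.mem_range'_1] at hv
    obtain ⟨i, rfl⟩ : ∃ i, v = i + 1 := ⟨v - 1, by omega⟩
    have := h i (Finset.mem_Icc.2 (by omega))
    simp only [hvq, false_or, Nat.add_sub_cancel]
    split_ifs at this with hi <;> simp only [hi, iff_true, iff_false] <;> omega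

theorem cover_eq_iff {q n : ℕ} (hq : 0 < q) (π : Equiv.Perm (Fin (n + q - 1))) {L : List ℕ}
    (hL : L.Perm (List.range' q n)) :
    cover q π = L ↔ ∀ j : Fin (n + q - 1), q - 1 ≤ (j : ℕ) →
      rankFun π j - (q - 1) = (rankCode L).getD (j - (q - 1)) 0 := by
  have hlen : (rankCode L).length = n := by
    rw [rankCode, length_rankCodeAux, hL.length_eq, List.length_range']
  have hinj : cover q π = L ↔ rankCode (cover q π) = rankCode L :=
    ⟨congrArg _, rankCode_injOn ((cover_perm hq π).trans hL.symm)⟩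
  have hmap := eq_map_range'_getD (rankCode L) q
  rw [hlen] at hmap
  generalize (rankCode L).getD = g at hmap ⊢
  rw [hinj, rankCode_cover hq, hmap, List.map_inj_left]
  constructor
  · intro h j hj
    have := h (j + 1) (by rw [List.mem_range'_1]; omega)
    rwa [show (j : ℕ) + 1 - q = j - (q - 1) by omega] at this
  · intro h k hk
    rw [List.mem_range'_1] at hk
    have := h ⟨k - 1, by omega⟩ (by simp only; omega)
    simp only [rankFun] at this
    rwa [show k - 1 + 1 = k by omega, show k - 1 - (q - 1) = k - q by omega] at this

theorem card_filter_cover_eq {q n : ℕ} (hq : 0 < q) {B : Finset ℕ} {L : List ℕ}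
    (hL : L.Perm (List.range' q n)) (hB : IsBlockShuffle q (n + q - 1) B L) :
    (Finset.univ.filter fun π : Equiv.Perm (Fin (n + q - 1)) => cover q π = L).card =
      (q - 1).factorial *
        ((List.range' q n).map fun v => if v = q ∨ v - 1 ∈ B then q else 1).prod := by
  have himage : (Finset.univ.filter fun π : Equiv.Perm (Fin (n + q - 1)) =>
      cover q π = L).image rankFun = Fintype.piFinset fun j : Fin (n + q - 1) =>
        (Finset.range (j + 1)).filter fun r =>
          q - 1 ≤ (j : ℕ) → r - (q - 1) = (rankCode L).getD (j - (q - 1)) 0 := by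
    ext f
    have := congrArg (f ∈ ·) (image_rankFun (n + q - 1))
    simp only [Finset.mem_image, Finset.mem_univ, true_and, Fintype.mem_piFinset,
      eq_iff_iff] at this
    simp only [Finset.mem_image, Finset.mem_filter, Finset.mem_univ, true_and,
      Fintype.mem_piFinset, forall_and, ← this, cover_eq_iff hq _ hL]
    constructor
    · rintro ⟨π, h, rfl⟩
      exact ⟨⟨π, rfl⟩, h⟩
    · rintro ⟨⟨π, rfl⟩, h⟩
      exact ⟨π, h, rfl⟩
  have hlen : (rankCode L).length = n := by
    rw [rankCode, length_rankCodeAux, hL.length_eq, List.length_range']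
  rw [← Finset.card_image_of_injective _ (rankFun_injective _), himage, Fintype.card_piFinset,
    Fin.prod_univ_eq_prod_range (fun j => ((Finset.range (j + 1)).filter fun r =>
      q - 1 ≤ j → r - (q - 1) = (rankCode L).getD (j - (q - 1)) 0).card),
    show n + q - 1 = q - 1 + n by omega, Finset.prod_range_add]
  congr 1
  · rw [← Finset.prod_range_add_one_eq_factorial]
    refine Finset.prod_congr rfl fun j hj => ?_
    rw [Finset.mem_range] at hj
    rw [Finset.filter_true_of_mem (fun r _ h => by omega), Finset.card_range]
  · have hfactor : ∀ k, ((Finset.range (q - 1 + k + 1)).filter fun r =>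
        q - 1 ≤ q - 1 + k → r - (q - 1) = (rankCode L).getD (q - 1 + k - (q - 1)) 0).card =
          if (rankCode L).getD k 0 = 0 then q else 1 := by
      intro k
      have hle := rankCodeAux_getD_le [] L k
      rw [← rankCode, List.length_nil, zero_add] at hle
      rw [add_tsub_cancel_left]
      generalize (rankCode L).getD k 0 = r at hle ⊢
      split_ifs with hr
      · refine (congrArg Finset.card ?_).trans (Finset.card_range q)
        ext x
        simp only [Finset.mem_filter, Finset.mem_range]
        omega
      · rw [Finset.card_eq_one]
        refine ⟨r + (q - 1), ?_⟩
        ext x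
        simp only [Finset.mem_filter, Finset.mem_range, Finset.mem_singleton]
        omega
    rw [Finset.prod_congr rfl fun k _ => hfactor k]
    have := prod_range_getD (fun r => if r = 0 then q else 1) (rankCode L)
    rw [hlen] at this
    rw [this, rankCode_eq_map (hL.nodup_iff.2 List.nodup_range'), List.map_map,
      (hL.map _).prod_eq]
    refine congrArg _ (List.map_congr_left fun v hv => ?_)
    simp only [Function.comp_apply, hB.smallerBefore_eq_zero_iff hL (by omega) hv]

open Classical in
/-- A sum over permutations whose covering is a block shuffle is, up to a constant factor,
a sum over the block shuffles. -/
theorem sum_pow_cover {q n : ℕ} (hq : 0 < q) (B : Finset ℕ) (stat : List ℕ → ℕ) :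
    ∑ π : Equiv.Perm (Fin (n + q - 1)) with IsBlockShuffle q (n + q - 1) B (cover q π),
        (Polynomial.X : Polynomial ℤ) ^ stat (cover q π) =
      ((q - 1).factorial *
          ((List.range' q n).map fun v => if v = q ∨ v - 1 ∈ B then q else 1).prod) •
        ∑ L ∈ (List.range' q n).permutations.toFinset.filter (IsBlockShuffle q (n + q - 1) B),
          (Polynomial.X : Polynomial ℤ) ^ stat L := by
  rw [Finset.smul_sum, ← Finset.sum_fiberwise_of_maps_to (g := cover q)
    (t := (List.range' q n).permutations.toFinset.filter (IsBlockShuffle q (n + q - 1) B))]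
  · refine Finset.sum_congr rfl fun L hL => ?_
    simp only [Finset.mem_filter, List.mem_toFinset, List.mem_permutations] at hL
    rw [← card_filter_cover_eq hq hL.1 hL.2, ← Finset.sum_const, Finset.filter_filter]
    refine Finset.sum_congr (Finset.filter_congr fun π _ => ?_) fun π hπ => ?_
    · constructor
      · exact And.right
      · rintro rfl
        exact ⟨hL.2, rfl⟩
    · rw [(Finset.mem_filter.1 hπ).2]
  · intro π hπ
    simp only [Finset.mem_filter, Finset.mem_univ, true_and, List.mem_toFinset,
      List.mem_permutations] at hπ ⊢
    exact ⟨cover_perm hq π, hπ⟩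

end PermList

open Classical in
/-- For all positive integers `q` and `n` and every subset
`B ⊆ {q,…,n+q-2}`, in `ℤ[t]`:
`Σ_{π : π⁻¹ ∈ Avoid_q(n+q-1), Des_q(π⁻¹)=B} t^{rmaj_{q,n+q-1}(π)}
 = Σ_{π : π⁻¹ ∈ Avoid_q(n+q-1), Des_q(π⁻¹)=B} t^{inv_q(π)}`. -/
theorem avoid_equidistribution (q n : ℕ) (hq : 0 < q) (hn : 0 < n) (B : Finset ℕ)
    (hB : B ⊆ Finset.Icc q (n + q - 2)) :
    (∑ π ∈ Finset.univ.filter (fun π : Equiv.Perm (Fin (n + q - 1)) =>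
          AvoidsPat q (n + q - 1) (natPerm π⁻¹) ∧
          DesQ q (n + q - 1) (natPerm π⁻¹) = B),
        (Polynomial.X : Polynomial ℤ) ^ rmajQ q (n + q - 1) (natPerm π)) =
      ∑ π ∈ Finset.univ.filter (fun π : Equiv.Perm (Fin (n + q - 1)) =>
          AvoidsPat q (n + q - 1) (natPerm π⁻¹) ∧
          DesQ q (n + q - 1) (natPerm π⁻¹) = B),
        (Polynomial.X : Polynomial ℤ) ^ invQ q (n + q - 1) (natPerm π) := by
  have hfilter : ∀ π : Equiv.Perm (Fin (n + q - 1)),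
      (AvoidsPat q (n + q - 1) (natPerm π⁻¹) ∧ DesQ q (n + q - 1) (natPerm π⁻¹) = B) ↔
        PermList.IsBlockShuffle q (n + q - 1) B (PermList.cover q π) :=
    fun π => (PermList.isBlockShuffle_cover_iff hq π hB).symm
  simp only [hfilter, PermList.rmajQ_eq_revMajor_cover hq, PermList.invQ_eq_inversions_cover hq]
  rw [PermList.sum_pow_cover hq, PermList.sum_pow_cover hq,
    PermList.sum_revMajor_eq_sum_inversions]
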